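/- On the bounded part Γ of the tropical hyperelliptic curve Γ̄ of genus g, the coordinate rational functions x and y, defined by x(P) = p and y(P) = q for P = (p,q) ∈ Γ, have principal divisors (x) = V_g + V_g′ − V_0 − V_0′ and (y) = (g+1)V_0′ − (g+1)V_0. -/

import Mathlib

open scoped BigOperators

namespace TropicalHyperelliptic

/-! ## The tropical hyperelliptic curve

For a genus `g ≥ 1` and parameters `c₋₁, c₀, …, c_{g+1}` (encoded as a function
`c : ℤ → ℝ`; only the values `c (-1), …, c (g+1)` matter), the tropical
polynomial `F̃(X,Y) = max(2Y, Y + P̃(X), c₋₁)` with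
`P̃(X) = max_{0 ≤ i ≤ g+1} (c_i + iX)` defines the tropical hyperelliptic curve
`Γ̄` as the locus of points of `ℝ²` where `F̃` fails to be differentiable. -/

/-- The tropical polynomial `P̃(X) = max_{0 ≤ i ≤ g+1} (c_i + i X)`. -/
noncomputable def Ptilde (g : ℕ) (c : ℤ → ℝ) (X : ℝ) : ℝ :=
  (Finset.range (g + 2)).sup' (Finset.nonempty_range_iff.mpr (by omega))
    fun i => c (i : ℤ) + (i : ℝ) * X

/-- The tropical polynomial `F̃(X,Y) = max(2Y, Y + P̃(X), c₋₁)`. -/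
noncomputable def Ftilde (g : ℕ) (c : ℤ → ℝ) (P : ℝ × ℝ) : ℝ :=
  max (2 * P.2) (max (P.2 + Ptilde g c P.1) (c (-1)))

/-- The tropical hyperelliptic curve `Γ̄` of genus `g`: the set of points of
`ℝ²` at which `F̃` is not differentiable. -/
def curveBar (g : ℕ) (c : ℤ → ℝ) : Set (ℝ × ℝ) :=
  {P | ¬ DifferentiableAt ℝ (Ftilde g c) P}

/-- The hypotheses on the parameters: `c_{g+1} = c_g = 0`, `c₋₁ < 2c₀`,
`cᵢ + c_{i+2} < 2c_{i+1}` for `0 ≤ i ≤ g − 2`, and `c_{g−1} < 2c_g = 0`.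
Under these assumptions `Γ̄` is a smooth tropical curve of genus `g`. -/
def Hyp (g : ℕ) (c : ℤ → ℝ) : Prop :=
  c ((g : ℤ) + 1) = 0 ∧ c (g : ℤ) = 0 ∧ c (-1) < 2 * c 0 ∧
  (∀ i : ℕ, (i : ℤ) ≤ (g : ℤ) - 2 → c i + c ((i : ℤ) + 2) < 2 * c ((i : ℤ) + 1)) ∧
  c ((g : ℤ) - 1) < 0

/-- The vertices `V_i` (`0 ≤ i ≤ g`) of `Γ̄` lying above the line
`Y = c₋₁/2`:  `V_0 = (0,0)` and
`V_i = (c_{g−i} − c_{g−i+1}, (g−i+1)c_{g−i} − (g−i)c_{g−i+1})`.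
(The formula below also gives `V_0 = (0,0)` for `i = 0`, since
`c_g = c_{g+1} = 0`.) -/
noncomputable def V (g : ℕ) (c : ℤ → ℝ) (i : ℕ) : ℝ × ℝ :=
  (c ((g : ℤ) - i) - c ((g : ℤ) - i + 1),
   (((g : ℤ) - i + 1 : ℤ) : ℝ) * c ((g : ℤ) - i)
     - (((g : ℤ) - i : ℤ) : ℝ) * c ((g : ℤ) - i + 1))

/-- The conjugate `P′` of a point `P`: the reflection with respect to the line
`Y = c₋₁/2`. -/
def conj (c : ℤ → ℝ) (P : ℝ × ℝ) : ℝ × ℝ := (P.1, c (-1) - P.2)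

/-- The metric graph `Γ` obtained from `Γ̄` by removing all unbounded edges:
the part of `Γ̄` lying in the vertical strip `x(V_g) ≤ X ≤ x(V_0) = 0`,
where `x(V_g) = c_0 − c_1`. -/
def Gam (g : ℕ) (c : ℤ → ℝ) : Set (ℝ × ℝ) :=
  {P ∈ curveBar g c | c 0 - c 1 ≤ P.1 ∧ P.1 ≤ 0}

/-! ## Rational functions, orders, and divisors -/

/-- The image in `ℝ²` of an integer vector. -/
def vr (v : ℤ × ℤ) : ℝ × ℝ := ((v.1 : ℝ), (v.2 : ℝ))

/-- The primitive integer directions along which one can leave the point `P`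
inside the set `S` (the outgoing directions of the segments of `S` emanating
from `P`). -/
def localDirs (S : Set (ℝ × ℝ)) (P : ℝ × ℝ) : Set (ℤ × ℤ) :=
  {v | IsCoprime v.1 v.2 ∧ ∃ ε > (0 : ℝ), ∀ t : ℝ, 0 < t → t < ε → P + t • vr v ∈ S}

/-- `f` has (integer) outgoing slope `s` at `P` in the direction `v` (slopes are
measured with respect to the lattice length). -/
def HasSlope (S : Set (ℝ × ℝ)) (f : ℝ × ℝ → ℝ) (P : ℝ × ℝ) (v : ℤ × ℤ) (s : ℤ) : Prop :=
  ∃ ε > (0 : ℝ), ∀ t : ℝ, 0 ≤ t → t < ε → P + t • vr v ∈ S →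
    f (P + t • vr v) = f P + (s : ℝ) * t

/-- A rational function on (the tropical curve) `S ⊆ ℝ²`: a continuous function
whose restriction to every edge is piecewise linear with integer slopes,
i.e. which has an integer outgoing slope at every point of `S` in every
outgoing direction. -/
structure IsRationalFn (S : Set (ℝ × ℝ)) (f : ℝ × ℝ → ℝ) : Prop where
  cont : ContinuousOn f S
  slope_int : ∀ P ∈ S, ∀ v ∈ localDirs S P, ∃ s : ℤ, HasSlope S f P v s

/-- The outgoing slope of `f` at `P` in the direction `v` (defaulting to `0`
when no integer slope exists). -/
noncomputable def slope (S : Set (ℝ × ℝ)) (f : ℝ × ℝ → ℝ) (P : ℝ × ℝ) (v : ℤ × ℤ) : ℤ :=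
  open scoped Classical in
  if h : ∃ s : ℤ, HasSlope S f P v s then h.choose else 0

/-- The order `ord_P f`: the sum of the outgoing slopes of `f` over all segments
of `S` emanating from `P`.  Points with `ord_P f > 0` are the zeros of `f`,
points with `ord_P f < 0` its poles. -/
noncomputable def ord (S : Set (ℝ × ℝ)) (f : ℝ × ℝ → ℝ) (P : ℝ × ℝ) : ℤ :=
  ∑ᶠ v ∈ localDirs S P, slope S f P v

/-- Divisors: formal `ℤ`-linear combinations of finitely many points of `ℝ²`. -/
abbrev Div := (ℝ × ℝ) →₀ ℤ

/-- The degree of a divisor: the sum of its coefficients. -/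
def deg (D : Div) : ℤ := D.sum fun _ n => n

/-- A divisor is effective (`D > 0`) when all its coefficients are nonnegative. -/
def Eff (D : Div) : Prop := ∀ P, 0 ≤ D P

/-- `R(D)`: the set of rational functions `f` on `S` with `(f) + D` effective. -/
def RSet (S : Set (ℝ × ℝ)) (D : Div) : Set ((ℝ × ℝ) → ℝ) :=
  {f | IsRationalFn S f ∧ ∀ P ∈ S, 0 ≤ ord S f P + D P}

/-- A divisor is principal when it is the divisor `(f) = Σ_P (ord_P f)·P` of a
rational function `f` on `S`. -/
def IsPrincipal (S : Set (ℝ × ℝ)) (D : Div) : Prop :=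
  ∃ f : (ℝ × ℝ) → ℝ, IsRationalFn S f ∧ ∀ P, D P = ord S f P

/-- Two divisors are (linearly) equivalent, `D ∼ D′`, when `D′ = D + (f)` for
some rational function `f` on `S`. -/
def LinEquiv (S : Set (ℝ × ℝ)) (D D' : Div) : Prop :=
  ∃ f : (ℝ × ℝ) → ℝ, IsRationalFn S f ∧ ∀ P, D' P = D P + ord S f P

end TropicalHyperelliptic

/-! ## The cycles `α_i` and the set `𝔇̃_g^+(Γ)` -/

namespace TropicalHyperelliptic

/-- The basis cycle `α_i` (`1 ≤ i ≤ g`) of the fundamental group `π₁(Γ)`: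
the cycle of `Γ` through the vertices `V_{i−1}`, `V_i` and their conjugates
`V_{i−1}′`, `V_i′`, i.e. the part of `Γ` in the vertical strip
`x(V_i) ≤ X ≤ x(V_{i−1})`. -/
def alphaCycle (g : ℕ) (c : ℤ → ℝ) (i : ℕ) : Set (ℝ × ℝ) :=
  {P ∈ Gam g c | (V g c i).1 ≤ P.1 ∧ P.1 ≤ (V g c (i - 1)).1}

/-- The overlap `α_{k,k+1} = (α_k ∩ α_{k+1}) ∖ {endpoints}` (`1 ≤ k ≤ g − 1`):
the open vertical edge of `Γ` joining `V_k` to `V_k′`.  (For non-adjacent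
indices the overlaps `α_i ∩ α_j` are empty.) -/
def alphaOpen (g : ℕ) (c : ℤ → ℝ) (k : ℕ) : Set (ℝ × ℝ) :=
  {P ∈ Gam g c | P.1 = (V g c k).1 ∧ P ≠ V g c k ∧ P ≠ conj c (V g c k)}

/-- The subset `𝔇̃_g^+(Γ)` of `𝔇_g^+(Γ)`: effective divisors
`P_1 + ⋯ + P_g` with `P_i ∈ α_i` for all `i`, such that each overlap `α_{ij}`
contains at most one of the points. -/
def Dtilde (g : ℕ) (c : ℤ → ℝ) : Set Div :=
  {D | ∃ Pt : Fin g → ℝ × ℝ,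
    (∀ i : Fin g, Pt i ∈ alphaCycle g c (i + 1)) ∧
    (∀ k : ℕ, 1 ≤ k → k ≤ g - 1 →
      ∀ i j : Fin g, Pt i ∈ alphaOpen g c k → Pt j ∈ alphaOpen g c k → i = j) ∧
    D = ∑ i : Fin g, Finsupp.single (Pt i) (1 : ℤ)}

/-- For even `g`, the base divisor `D* = (g/2)(V_0 + V_0′)`. -/
noncomputable def DstarEven (g : ℕ) (c : ℤ → ℝ) : Div :=
  ((g / 2 : ℕ) : ℤ) •
    (Finsupp.single (V g c 0) (1 : ℤ) + Finsupp.single (conj c (V g c 0)) (1 : ℤ))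

/-- For odd `g`, the base divisor `D* = ((g−1)/2)(V_0 + V_0′) + V_0`. -/
noncomputable def DstarOdd (g : ℕ) (c : ℤ → ℝ) : Div :=
  (((g - 1) / 2 : ℕ) : ℤ) •
    (Finsupp.single (V g c 0) (1 : ℤ) + Finsupp.single (conj c (V g c 0)) (1 : ℤ))
  + Finsupp.single (V g c 0) (1 : ℤ)

end TropicalHyperelliptic

namespace TropicalHyperelliptic

/-! ## Auxiliary facts for the proof -/

/-- The breakpoints of `P̃`. -/
noncomputable def br (c : ℤ → ℝ) (k : ℕ) : ℝ := c (k : ℤ) - c ((k : ℤ) + 1)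

/-- Being one of the breakpoints. -/
def Br (g : ℕ) (c : ℤ → ℝ) (X : ℝ) : Prop := ∃ k : ℕ, k ≤ g ∧ X = br c k

/-- Half of the height of the curve above `X`. -/
noncomputable def QQ (g : ℕ) (c : ℤ → ℝ) (X : ℝ) : ℝ := Ptilde g c X - c (-1) / 2

lemma br_lt {g : ℕ} {c : ℤ → ℝ} (hc : Hyp g c) (i : ℕ) (hi : i + 1 ≤ g) :
    br c i < br c (i + 1) := by
  obtain ⟨h1, h2, h3, h4, h5⟩ := hc
  unfold br
  push_cast
  rcases Nat.lt_or_ge (i + 1) g with h | h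
  · have := h4 i (by omega)
    rw [show (i : ℤ) + 1 + 1 = (i : ℤ) + 2 by ring]
    linarith
  · obtain rfl : g = i + 1 := by omega
    push_cast at h1 h2 h5
    rw [h1, h2]
    simp at h5 ⊢
    linarith

lemma br_le {g : ℕ} {c : ℤ → ℝ} (hc : Hyp g c) (i j : ℕ) (hij : i ≤ j) (hj : j ≤ g) :
    br c i ≤ br c j := by
  induction j, hij using Nat.le_induction with
  | base => exact le_rfl
  | succ n hn ih => exact (ih (by omega)).trans (br_lt hc n hj).le

lemma br_lt' {g : ℕ} {c : ℤ → ℝ} (hc : Hyp g c) (i j : ℕ) (hij : i < j) (hj : j ≤ g) :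
    br c i < br c j :=
  lt_of_lt_of_le (br_lt hc i (by omega)) (br_le hc (i + 1) j hij hj)

lemma br_g {g : ℕ} {c : ℤ → ℝ} (hc : Hyp g c) : br c g = 0 := by
  obtain ⟨h1, h2, -⟩ := hc
  simp [br, h1, h2]

lemma Ptilde_ge (g : ℕ) (c : ℤ → ℝ) (X : ℝ) (i : ℕ) (hi : i ≤ g + 1) :
    c (i : ℤ) + (i : ℝ) * X ≤ Ptilde g c X :=
  Finset.le_sup' (fun i : ℕ => c (i : ℤ) + (i : ℝ) * X) (Finset.mem_range.mpr (by omega))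

lemma Ptilde_eq {g : ℕ} {c : ℤ → ℝ} (hc : Hyp g c) (X : ℝ) (k : ℕ) (hk : k ≤ g + 1)
    (hl : ∀ j, j + 1 = k → br c j ≤ X) (hr : k ≤ g → X ≤ br c k) :
    Ptilde g c X = c (k : ℤ) + (k : ℝ) * X := by
  apply le_antisymm _ (Ptilde_ge g c X k hk)
  apply Finset.sup'_le
  intro i hi
  have hi' : i ≤ g + 1 := by have := Finset.mem_range.mp hi; omega
  clear hi
  rcases le_total k i with h | h
  · induction i, h using Nat.le_induction with
    | base => exact le_rfl
    | succ n hn ih =>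
      have h1 := ih (by omega)
      have h2 : X ≤ br c n := (hr (by omega)).trans (br_le hc k n hn (by omega))
      unfold br at h2
      push_cast
      linarith
  · induction h using Nat.decreasingInduction with
    | self => exact le_rfl
    | of_succ n hn ih =>
      have h1 := ih (by omega)
      have h2 : br c n ≤ X := by
        obtain ⟨j, rfl⟩ : ∃ j, k = j + 1 := ⟨k - 1, by omega⟩
        exact (br_le hc n j (by omega) (by omega)).trans (hl j rfl)
      unfold br at h2
      push_cast at h1
      linarith

lemma local_right {g : ℕ} {c : ℤ → ℝ} (hc : Hyp g c) (X : ℝ) (k : ℕ) (hk : k ≤ g + 1)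
    (hl : ∀ j, j + 1 = k → br c j ≤ X) (hr : k ≤ g → X < br c k) :
    ∃ ε > (0 : ℝ), ∀ t : ℝ, 0 ≤ t → t < ε → QQ g c (X + t) = QQ g c X + k * t ∧
      (0 < t → ¬ Br g c (X + t)) := by
  refine ⟨if k ≤ g then br c k - X else 1, ?_, ?_⟩
  · split_ifs with h
    · have := hr h; linarith
    · norm_num
  · intro t ht0 ht
    have hr' : k ≤ g → X + t < br c k := by
      intro h; rw [if_pos h] at ht; linarith
    refine ⟨?_, ?_⟩
    · unfold QQ
      rw [Ptilde_eq hc X k hk hl (fun h => (hr h).le),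
        Ptilde_eq hc (X + t) k hk (fun j hj => by have := hl j hj; linarith)
          (fun h => (hr' h).le)]
      ring
    · rintro h0 ⟨i, hi, hX⟩
      rcases Nat.lt_or_ge i k with h | h
      · obtain ⟨j, rfl⟩ : ∃ j, k = j + 1 := ⟨k - 1, by omega⟩
        have h1 := br_le hc i j (by omega) (by omega)
        have h2 := hl j rfl
        linarith
      · have h1 := br_le hc k i h hi
        have h2 := hr' (by omega)
        linarith

lemma local_left {g : ℕ} {c : ℤ → ℝ} (hc : Hyp g c) (X : ℝ) (k : ℕ) (hk : k ≤ g + 1)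
    (hl : ∀ j, j + 1 = k → br c j < X) (hr : k ≤ g → X ≤ br c k) :
    ∃ ε > (0 : ℝ), ∀ t : ℝ, 0 ≤ t → t < ε → QQ g c (X - t) = QQ g c X - k * t ∧
      (0 < t → ¬ Br g c (X - t)) := by
  refine ⟨if 0 < k then X - br c (k - 1) else 1, ?_, ?_⟩
  · split_ifs with h
    · have := hl (k - 1) (by omega); linarith
    · norm_num
  · intro t ht0 ht
    have hl' : ∀ j, j + 1 = k → br c j < X - t := by
      rintro j rfl; rw [if_pos (by omega)] at ht; simp at ht; linarith
    refine ⟨?_, ?_⟩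
    · unfold QQ
      rw [Ptilde_eq hc X k hk (fun j hj => (hl j hj).le) hr,
        Ptilde_eq hc (X - t) k hk (fun j hj => (hl' j hj).le)
          (fun h => by have := hr h; linarith)]
      ring
    · rintro h0 ⟨i, hi, hX⟩
      rcases Nat.lt_or_ge i k with h | h
      · obtain ⟨j, rfl⟩ : ∃ j, k = j + 1 := ⟨k - 1, by omega⟩
        have h1 := br_le hc i j (by omega) (by omega)
        have h2 := hl' j rfl
        linarith
      · have h1 := br_le hc k i h hi
        have h2 := hr (by omega)
        linarith

lemma locate {g : ℕ} {c : ℤ → ℝ} (X : ℝ) (h0 : br c 0 ≤ X) (k : ℕ) (hk : k ≤ g)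
    (hX : X ≤ br c k) :
    (∃ i ≤ g, X = br c i) ∨ ∃ j, j + 1 ≤ g ∧ br c j < X ∧ X < br c (j + 1) := by
  induction k with
  | zero => exact Or.inl ⟨0, by omega, le_antisymm hX h0⟩
  | succ n ih =>
    rcases le_or_gt X (br c n) with h | h
    · exact ih (by omega) h
    · rcases hX.eq_or_lt with h' | h'
      · exact Or.inl ⟨n + 1, hk, h'⟩
      · exact Or.inr ⟨n, hk, h, h'⟩

lemma local_struct {g : ℕ} {c : ℤ → ℝ} (hc : Hyp g c) (X : ℝ) (h0 : br c 0 ≤ X) (h1 : X ≤ 0) :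
    ∃ m n : ℕ, ∃ ε > (0 : ℝ),
      (∀ t : ℝ, 0 ≤ t → t < ε → QQ g c (X + t) = QQ g c X + n * t) ∧
      (∀ t : ℝ, 0 ≤ t → t < ε → QQ g c (X - t) = QQ g c X - m * t) ∧
      (∀ t : ℝ, 0 < t → t < ε → ¬ Br g c (X + t)) ∧
      (∀ t : ℝ, 0 < t → t < ε → ¬ Br g c (X - t)) ∧
      (X = br c 0 → m = 0) ∧ (X = 0 → m = g) ∧
      (Br g c X → n = m + 1) ∧ (¬ Br g c X → n = m) := by
  rcases locate X h0 g le_rfl (by rw [br_g hc]; exact h1) with ⟨k, hk, rfl⟩ | ⟨j, hj, hl, hr⟩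
  · obtain ⟨e1, he1, H1⟩ := local_right hc (br c k) (k + 1) (by omega)
      (fun j hj => by obtain rfl : j = k := by omega
                      exact le_rfl) (fun h => br_lt hc k h)
    obtain ⟨e2, he2, H2⟩ := local_left hc (br c k) k (by omega)
      (fun j hj => by subst hj; exact br_lt hc j hk) (fun h => le_rfl)
    refine ⟨k, k + 1, min e1 e2, lt_min he1 he2,
      fun t a b => (H1 t a (lt_of_lt_of_le b (min_le_left _ _))).1,
      fun t a b => (H2 t a (lt_of_lt_of_le b (min_le_right _ _))).1,
      fun t a b => (H1 t a.le (lt_of_lt_of_le b (min_le_left _ _))).2 a,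
      fun t a b => (H2 t a.le (lt_of_lt_of_le b (min_le_right _ _))).2 a,
      ?_, ?_, fun _ => rfl, fun h => absurd ⟨k, hk, rfl⟩ h⟩
    · intro h
      by_contra hne
      have := br_lt' hc 0 k (by omega) hk
      linarith
    · intro h
      by_contra hne
      have := br_lt' hc k g (by omega) le_rfl
      rw [br_g hc] at this
      linarith
  · have hB : ¬ Br g c X := by
      rintro ⟨i, hi, rfl⟩
      rcases Nat.lt_or_ge j i with h | h
      · have := br_le hc (j + 1) i h hi
        linarith
      · have := br_le hc i j h (by omega)
        linarith
    obtain ⟨e1, he1, H1⟩ := local_right hc X (j + 1) (by omega)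
      (fun i hi => by obtain rfl : i = j := by omega
                      exact hl.le) (fun h => hr)
    obtain ⟨e2, he2, H2⟩ := local_left hc X (j + 1) (by omega)
      (fun i hi => by obtain rfl : i = j := by omega
                      exact hl) (fun h => hr.le)
    refine ⟨j + 1, j + 1, min e1 e2, lt_min he1 he2,
      fun t a b => (H1 t a (lt_of_lt_of_le b (min_le_left _ _))).1,
      fun t a b => (H2 t a (lt_of_lt_of_le b (min_le_right _ _))).1,
      fun t a b => (H1 t a.le (lt_of_lt_of_le b (min_le_left _ _))).2 a,
      fun t a b => (H2 t a.le (lt_of_lt_of_le b (min_le_right _ _))).2 a,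
      ?_, ?_, fun h => absurd h hB, fun _ => rfl⟩
    · intro h
      have := br_le hc 0 j (by omega) (by omega)
      linarith
    · intro h
      have := br_le hc (j + 1) g hj le_rfl
      rw [br_g hc] at this
      linarith

lemma QQ_pos {g : ℕ} {c : ℤ → ℝ} (hc : Hyp g c) (X : ℝ) : 0 < QQ g c X := by
  have := Ptilde_ge g c X 0 (by omega)
  have h3 := hc.2.2.1
  unfold QQ
  simp at this
  linarith

lemma Ptilde_cont (g : ℕ) (c : ℤ → ℝ) : Continuous (Ptilde g c) := by
  unfold Ptilde
  apply Continuous.finset_sup'_apply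
  intro i _
  fun_prop

lemma QQ_cont (g : ℕ) (c : ℤ → ℝ) : Continuous (QQ g c) := by
  unfold QQ
  exact (Ptilde_cont g c).sub continuous_const

lemma kink (f : ℝ → ℝ) (X m n ε : ℝ) (hε : 0 < ε) (hmn : m ≠ n)
    (hr : ∀ t : ℝ, 0 ≤ t → t < ε → f (X + t) = f X + n * t)
    (hl : ∀ t : ℝ, 0 ≤ t → t < ε → f (X - t) = f X - m * t) :
    ¬ DifferentiableAt ℝ f X := by
  intro hd
  have hD := hd.hasDerivAt
  have aff : ∀ a : ℝ, HasDerivAt (fun s => f X + a * (s - X)) a X := by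
    intro a
    have := (((hasDerivAt_id X).sub_const X).const_mul a).const_add (f X)
    simpa using this
  have e1 : HasDerivWithinAt f n (Set.Ici X) X := by
    refine (aff n).hasDerivWithinAt.congr_of_eventuallyEq ?_ (by simp)
    have : Set.Iio (X + ε) ∈ nhds X := Iio_mem_nhds (by linarith)
    filter_upwards [self_mem_nhdsWithin, mem_nhdsWithin_of_mem_nhds this] with s hs hs'
    have := hr (s - X) (by simpa using hs) (by simp at hs'; linarith)
    simpa using this
  have e2 : HasDerivWithinAt f m (Set.Iic X) X := by
    refine (aff m).hasDerivWithinAt.congr_of_eventuallyEq ?_ (by simp)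
    have : Set.Ioi (X - ε) ∈ nhds X := Ioi_mem_nhds (by linarith)
    filter_upwards [self_mem_nhdsWithin, mem_nhdsWithin_of_mem_nhds this] with s hs hs'
    have := hl (X - s) (by simpa using hs) (by simp at hs'; linarith)
    simp at this
    linarith
  have u1 := (uniqueDiffWithinAt_Ici X).eq_deriv _ e1 hD.hasDerivWithinAt
  have u2 := (uniqueDiffWithinAt_Iic X).eq_deriv _ e2 hD.hasDerivWithinAt
  exact hmn (u2.trans u1.symm)

lemma Ftilde_eq (g : ℕ) (c : ℤ → ℝ) (X Y : ℝ) :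
    Ftilde g c (X, Y) = max (2 * Y) (max (Y + QQ g c X + c (-1) / 2) (c (-1))) := by
  unfold Ftilde QQ
  ring_nf

lemma mem_curveBar {g : ℕ} {c : ℤ → ℝ} (hc : Hyp g c) (X Y : ℝ) (h0 : br c 0 ≤ X) (h1 : X ≤ 0) :
    (X, Y) ∈ curveBar g c ↔
      |Y - c (-1) / 2| = QQ g c X ∨ (|Y - c (-1) / 2| ≤ QQ g c X ∧ Br g c X) := by
  have hQ := QQ_pos hc X
  have hQc := QQ_cont g c
  rcases lt_trichotomy |Y - c (-1) / 2| (QQ g c X) with h | h | h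
  · have hab := abs_lt.mp h
    have hev : Ftilde g c =ᶠ[nhds (X, Y)] fun p => p.2 + QQ g c p.1 + c (-1) / 2 := by
      have ho : IsOpen {p : ℝ × ℝ | |p.2 - c (-1) / 2| < QQ g c p.1} :=
        isOpen_lt (by fun_prop) (hQc.comp continuous_fst)
      filter_upwards [ho.mem_nhds (show (X, Y) ∈ _ from h)] with p hp
      have hp' := abs_lt.mp hp
      rw [show p = (p.1, p.2) from rfl, Ftilde_eq, max_eq_left (b := c (-1)), max_eq_right]
      · linarith
      · linarith
    obtain ⟨m, n, ε, hε, Hr, Hl, -, -, -, -, hB, hNB⟩ := local_struct hc X h0 h1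
    have key : (X, Y) ∈ curveBar g c ↔ Br g c X := by
      unfold curveBar
      rw [Set.mem_ofPred_eq, hev.differentiableAt_iff]
      constructor
      · intro hnd
        by_contra hb
        have hmn := hNB hb
        subst hmn
        apply hnd
        have hq : DifferentiableAt ℝ (QQ g c) X := by
          have : QQ g c =ᶠ[nhds X] fun s => QQ g c X + n * (s - X) := by
            filter_upwards [Ioo_mem_nhds (show X - ε < X by linarith) (show X < X + ε by linarith)]
              with s hs
            rcases le_total X s with hh | hh
            · have := Hr (s - X) (by linarith) (by linarith [hs.2])
              simpa using this
            · have := Hl (X - s) (by linarith) (by linarith [hs.1])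
              simp at this
              linarith
          rw [this.differentiableAt_iff]
          fun_prop
        have hq' : DifferentiableAt ℝ (fun p : ℝ × ℝ => QQ g c p.1) (X, Y) :=
          DifferentiableAt.comp (X, Y) (g := QQ g c) hq differentiableAt_fst
        fun_prop
      · intro hb hd
        have hmn := hB hb
        have hd' : DifferentiableAt ℝ (fun s : ℝ => Y + QQ g c s + c (-1) / 2) X := by
          have := DifferentiableAt.comp X (f := fun s : ℝ => (s, Y))
            (g := fun p : ℝ × ℝ => p.2 + QQ g c p.1 + c (-1) / 2) hd (by fun_prop)
          exact this
        refine kink _ X m n ε hε (by rw [hmn]; push_cast; linarith) ?_ ?_ hd'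
        · intro t a b
          simp only [Hr t a b]; ring
        · intro t a b
          simp only [Hl t a b]; ring
    rw [key]
    constructor
    · exact fun hb => Or.inr ⟨h.le, hb⟩
    · rintro (h' | h')
      · linarith
      · exact h'.2
  · simp only [h, true_or, iff_true]
    intro hd
    have hd' : DifferentiableAt ℝ (fun s : ℝ => Ftilde g c (X, s)) Y :=
      DifferentiableAt.comp Y (f := fun s : ℝ => (X, s)) hd (by fun_prop)
    revert hd'
    rcases abs_choice (Y - c (-1) / 2) with h' | h' <;> rw [h'] at h
    · apply kink _ Y 1 2 (QQ g c X) hQ (by norm_num)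
      · intro t a b
        simp only [Ftilde_eq]
        repeat' rw [max_eq_left]
        all_goals linarith
      · intro t a b
        simp only [Ftilde_eq]
        rw [max_eq_left (b := c (-1)), max_eq_left (b := c (-1)), max_eq_right, max_eq_right]
        all_goals linarith
    · apply kink _ Y 0 1 (QQ g c X) hQ (by norm_num)
      · intro t a b
        simp only [Ftilde_eq]
        rw [max_eq_left (b := c (-1)), max_eq_left (b := c (-1)), max_eq_right, max_eq_right]
        all_goals linarith
      · intro t a b
        simp only [Ftilde_eq]
        rw [max_eq_right (a := Y - t + QQ g c X + c (-1) / 2),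
          max_eq_right (a := Y + QQ g c X + c (-1) / 2), max_eq_right, max_eq_right]
        all_goals linarith
  · have : (X, Y) ∉ curveBar g c := by
      intro hd
      apply hd
      rcases lt_abs.mp h with h' | h'
      · have ho : IsOpen {p : ℝ × ℝ | QQ g c p.1 < p.2 - c (-1) / 2} :=
          isOpen_lt (hQc.comp continuous_fst) (by fun_prop)
        have hev : Ftilde g c =ᶠ[nhds (X, Y)] fun p => 2 * p.2 := by
          filter_upwards [ho.mem_nhds (show (X, Y) ∈ _ from h')] with p hp
          have hp' : QQ g c p.1 < p.2 - c (-1) / 2 := hp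
          have := QQ_pos hc p.1
          rw [show p = (p.1, p.2) from rfl, Ftilde_eq, max_eq_left]
          apply max_le <;> linarith
        rw [hev.differentiableAt_iff]
        fun_prop
      · have ho : IsOpen {p : ℝ × ℝ | QQ g c p.1 < -(p.2 - c (-1) / 2)} :=
          isOpen_lt (hQc.comp continuous_fst) (by fun_prop)
        have hev : Ftilde g c =ᶠ[nhds (X, Y)] fun p => c (-1) := by
          filter_upwards [ho.mem_nhds (show (X, Y) ∈ _ from h')] with p hp
          have hp' : QQ g c p.1 < -(p.2 - c (-1) / 2) := hp
          have := QQ_pos hc p.1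
          rw [show p = (p.1, p.2) from rfl, Ftilde_eq, max_eq_right (b := c (-1)), max_eq_right]
          all_goals linarith
        rw [hev.differentiableAt_iff]
        fun_prop
    constructor
    · intro h'; exact absurd h' this
    · rintro (h' | ⟨h', -⟩) <;> linarith

lemma mem_Gam {g : ℕ} {c : ℤ → ℝ} (hc : Hyp g c) (X Y : ℝ) :
    (X, Y) ∈ Gam g c ↔ (br c 0 ≤ X ∧ X ≤ 0) ∧
      (|Y - c (-1) / 2| = QQ g c X ∨ (|Y - c (-1) / 2| ≤ QQ g c X ∧ Br g c X)) := by
  have : br c 0 = c 0 - c 1 := by simp [br]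
  rw [this]
  constructor
  · rintro ⟨h1, h2⟩
    exact ⟨h2, (mem_curveBar hc X Y (by rw [this]; exact h2.1) h2.2).mp h1⟩
  · rintro ⟨h2, h1⟩
    exact ⟨(mem_curveBar hc X Y (by rw [this]; exact h2.1) h2.2).mpr h1, h2⟩

lemma Gam_closed {g : ℕ} {c : ℤ → ℝ} (hc : Hyp g c) : IsClosed (Gam g c) := by
  have hQc := (QQ_cont g c).comp (continuous_fst (X := ℝ) (Y := ℝ))
  have hBr : IsClosed {X : ℝ | Br g c X} := by
    have : {X : ℝ | Br g c X} = (fun k => br c k) '' (Set.Iic g) := by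
      ext X
      simp only [Br, Set.mem_ofPred_eq, Set.mem_image, Set.mem_Iic, eq_comm]
    rw [this]
    exact ((Set.finite_Iic g).image _).isClosed
  have : Gam g c = ({p : ℝ × ℝ | br c 0 ≤ p.1} ∩ {p | p.1 ≤ 0}) ∩
      ({p | |p.2 - c (-1) / 2| = QQ g c p.1} ∪
        ({p | |p.2 - c (-1) / 2| ≤ QQ g c p.1} ∩ Prod.fst ⁻¹' {X : ℝ | Br g c X})) := by
    ext ⟨X, Y⟩
    rw [mem_Gam hc]
    rfl
  rw [this]
  refine ((isClosed_le (by fun_prop) (by fun_prop)).inter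
    (isClosed_le (by fun_prop) (by fun_prop))).inter
    ((isClosed_eq (by fun_prop) hQc).union ((isClosed_le (by fun_prop) hQc).inter
      (hBr.preimage continuous_fst)))

lemma mem_of_localDirs {g : ℕ} {c : ℤ → ℝ} (hc : Hyp g c) (P : ℝ × ℝ) (v : ℤ × ℤ)
    (hv : v ∈ localDirs (Gam g c) P) : P ∈ Gam g c := by
  obtain ⟨-, ε, hε, H⟩ := hv
  have ht : Filter.Tendsto (fun t : ℝ => P + t • vr v) (nhdsWithin 0 (Set.Ioi 0)) (nhds P) := by
    have : Continuous (fun t : ℝ => P + t • vr v) := by fun_prop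
    have h := (this.tendsto 0).mono_left (nhdsWithin_le_nhds (s := Set.Ioi (0 : ℝ)))
    simpa using h
  refine (Gam_closed hc).mem_of_tendsto ht ?_
  filter_upwards [Ioo_mem_nhdsGT hε] with t ht
  exact H t ht.1 ht.2

lemma add_smul_vr (X Y t : ℝ) (p q : ℤ) :
    ((X, Y) : ℝ × ℝ) + t • vr (p, q) = (X + t * p, Y + t * q) := by
  simp [vr]

lemma abs_sign_mul (σ : ℤ) (hσ : σ = 1 ∨ σ = -1) (a : ℝ) : |(σ : ℝ) * a| = |a| := by
  rcases hσ with rfl | rfl <;> simp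

/-- Outgoing directions at the upper (`σ = 1`) or lower (`σ = -1`) points. -/
lemma localDirs_edge {g : ℕ} {c : ℤ → ℝ} (hc : Hyp g c) (X : ℝ) (h0 : br c 0 ≤ X) (h1 : X ≤ 0)
    (σ : ℤ) (hσ : σ = 1 ∨ σ = -1) (m n : ℕ) (ε : ℝ) (hε : 0 < ε)
    (Hr : ∀ t : ℝ, 0 ≤ t → t < ε → QQ g c (X + t) = QQ g c X + n * t)
    (Hl : ∀ t : ℝ, 0 ≤ t → t < ε → QQ g c (X - t) = QQ g c X - m * t)
    (Br' : ∀ t : ℝ, 0 < t → t < ε → ¬ Br g c (X + t))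
    (Bl' : ∀ t : ℝ, 0 < t → t < ε → ¬ Br g c (X - t)) (v : ℤ × ℤ) :
    v ∈ localDirs (Gam g c) (X, c (-1) / 2 + σ * QQ g c X) ↔
      (X < 0 ∧ v = (1, σ * n)) ∨ (br c 0 < X ∧ v = (-1, -(σ * m))) ∨
      (Br g c X ∧ v = (0, -σ)) := by
  have hQ := QQ_pos hc X
  have hσ2 : (σ : ℝ) * σ = 1 := by rcases hσ with rfl | rfl <;> simp
  have hσ2' : σ * σ = 1 := by rcases hσ with rfl | rfl <;> simp
  have shift : ∀ t q : ℝ, |c (-1) / 2 + σ * QQ g c X + t * q - c (-1) / 2|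
      = |QQ g c X + t * (σ * q)| := by
    intro t q
    rw [← abs_sign_mul σ hσ (QQ g c X + t * (σ * q))]
    congr 1
    linear_combination (-(t * q)) * hσ2
  obtain ⟨p, q⟩ := v
  constructor
  · rintro ⟨hcop, δ, hδ, H⟩
    simp only [add_smul_vr, mem_Gam hc, shift] at H
    simp only at hcop
    have hA : (0 : ℝ) < 1 + |(p : ℝ)| := by positivity
    have hC : (0 : ℝ) < 1 + |(q : ℝ)| := by positivity
    obtain ⟨t, ht0, ht⟩ : ∃ t : ℝ, 0 < t ∧
        t < min δ (min (ε / (1 + |(p : ℝ)|)) (QQ g c X / (1 + |(q : ℝ)|))) :=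
      exists_between (lt_min hδ (lt_min (div_pos hε hA) (div_pos hQ hC)))
    have ht1 : t < δ := lt_of_lt_of_le ht (min_le_left _ _)
    have ht2 : t * (1 + |(p : ℝ)|) < ε :=
      (lt_div_iff₀ hA).mp (lt_of_lt_of_le ht ((min_le_right _ _).trans (min_le_left _ _)))
    have ht3 : t * (1 + |(q : ℝ)|) < QQ g c X :=
      (lt_div_iff₀ hC).mp (lt_of_lt_of_le ht ((min_le_right _ _).trans (min_le_right _ _)))
    have hpos : 0 < QQ g c X + t * (σ * q) := by
      have h : |(σ : ℝ) * q| = |(q : ℝ)| := abs_sign_mul σ hσ q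
      have h' := neg_abs_le ((σ : ℝ) * q)
      rw [h] at h'
      nlinarith
    obtain ⟨⟨hx0, hx1⟩, hy⟩ := H t ht0 ht1
    rw [abs_of_pos hpos] at hy
    rcases lt_trichotomy p 0 with hp | rfl | hp
    · right; left
      have hpr : (p : ℝ) < 0 := by exact_mod_cast hp
      rw [abs_of_neg hpr] at ht2
      have hs : 0 < t * (-p : ℝ) := mul_pos ht0 (by linarith)
      have hsε : t * (-p : ℝ) < ε := by nlinarith
      have e : X + t * p = X - t * (-p : ℝ) := by ring
      rw [e] at hy hx0
      rw [Hl _ hs.le hsε] at hy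
      have hb := Bl' _ hs hsε
      have hy' : QQ g c X + t * (σ * q) = QQ g c X - m * (t * (-p : ℝ)) := by tauto
      have hq : (σ : ℝ) * q = m * p := by
        apply mul_left_cancel₀ ht0.ne'
        linarith
      have hq' : σ * q = m * p := by exact_mod_cast hq
      have hq2 : q = (σ * m) * p := by
        linear_combination σ * hq' - q * hσ2'
      refine ⟨by linarith, ?_⟩
      have hu : IsUnit p := by
        rw [hq2] at hcop
        exact hcop.isUnit_of_dvd' dvd_rfl (Dvd.intro_left _ rfl)
      have hp1 : p = -1 := by
        rcases Int.isUnit_iff.mp hu with h | h <;> omega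
      subst hp1
      rw [hq2]; simp
    · right; right
      have hq : q = 1 ∨ q = -1 := Int.isUnit_iff.mp (isCoprime_zero_left.mp hcop)
      simp only [Int.cast_zero, mul_zero, add_zero] at hy
      have hqs : q = σ ∨ q = -σ := by omega
      rcases hqs with rfl | rfl
      · exfalso
        rw [hσ2] at hy
        rcases hy with hy | ⟨hy, -⟩ <;> linarith
      · push_cast at hy
        have e : (σ : ℝ) * (-σ) = -1 := by linarith
        rw [e] at hy
        refine ⟨?_, rfl⟩
        rcases hy with hy | ⟨-, hy⟩
        · linarith
        · exact hy
    · left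
      have hpr : (0 : ℝ) < p := by exact_mod_cast hp
      rw [abs_of_pos hpr] at ht2
      have hs : 0 < t * (p : ℝ) := mul_pos ht0 (by linarith)
      have hsε : t * (p : ℝ) < ε := by nlinarith
      rw [Hr _ hs.le hsε] at hy
      have hb := Br' _ hs hsε
      have hy' : QQ g c X + t * (σ * q) = QQ g c X + n * (t * (p : ℝ)) := by tauto
      have hq : (σ : ℝ) * q = n * p := by
        apply mul_left_cancel₀ ht0.ne'
        linarith
      have hq' : σ * q = n * p := by exact_mod_cast hq
      have hq2 : q = (σ * n) * p := by
        linear_combination σ * hq' - q * hσ2'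
      refine ⟨by linarith, ?_⟩
      have hu : IsUnit p := by
        rw [hq2] at hcop
        exact hcop.isUnit_of_dvd' dvd_rfl (Dvd.intro_left _ rfl)
      have hp1 : p = 1 := by
        rcases Int.isUnit_iff.mp hu with h | h <;> omega
      subst hp1
      rw [hq2]; simp
  · rintro (⟨hX, hv⟩ | ⟨hX, hv⟩ | ⟨hX, hv⟩) <;> obtain ⟨rfl, rfl⟩ := Prod.mk.inj hv
    · refine ⟨isCoprime_one_left, min ε (-X), lt_min hε (by linarith), ?_⟩
      intro t ht0 ht
      have ht1 := lt_of_lt_of_le ht (min_le_left _ _)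
      have ht2 := lt_of_lt_of_le ht (min_le_right _ _)
      rw [add_smul_vr, mem_Gam hc, shift]
      have e : X + t * ((1 : ℤ) : ℝ) = X + t := by simp
      rw [e, Hr t ht0.le ht1]
      refine ⟨⟨by linarith, by linarith⟩, Or.inl ?_⟩
      have e2 : QQ g c X + t * ((σ : ℝ) * ((σ * (n : ℤ) : ℤ) : ℝ)) = QQ g c X + n * t := by
        push_cast
        linear_combination (t * n) * hσ2
      rw [e2, abs_of_pos]
      positivity
    · refine ⟨isCoprime_one_left.neg_left, min ε (X - br c 0), lt_min hε (by linarith), ?_⟩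
      intro t ht0 ht
      have ht1 := lt_of_lt_of_le ht (min_le_left _ _)
      have ht2 := lt_of_lt_of_le ht (min_le_right _ _)
      rw [add_smul_vr, mem_Gam hc, shift]
      have e : X + t * ((-1 : ℤ) : ℝ) = X - t := by push_cast; ring
      have hpos := QQ_pos hc (X - t)
      rw [e]
      rw [Hl t ht0.le ht1] at hpos ⊢
      refine ⟨⟨by linarith, by linarith⟩, Or.inl ?_⟩
      have e2 : QQ g c X + t * ((σ : ℝ) * ((-(σ * (m : ℤ)) : ℤ) : ℝ)) = QQ g c X - m * t := by
        push_cast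
        linear_combination (-(t * m)) * hσ2
      rw [e2, abs_of_pos hpos]
    · refine ⟨?_, QQ g c X, hQ, ?_⟩
      · rcases hσ with rfl | rfl
        · exact isCoprime_one_right.neg_right
        · exact isCoprime_one_right
      intro t ht0 ht
      rw [add_smul_vr, mem_Gam hc, shift]
      have e : X + t * ((0 : ℤ) : ℝ) = X := by simp
      rw [e]
      refine ⟨⟨h0, h1⟩, Or.inr ⟨?_, hX⟩⟩
      have e2 : QQ g c X + t * ((σ : ℝ) * ((-σ : ℤ) : ℝ)) = QQ g c X - t := by
        push_cast
        linear_combination (-t) * hσ2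
      rw [e2, abs_of_pos] <;> linarith

/-- Outgoing directions at the interior points of the vertical edges. -/
lemma localDirs_mid {g : ℕ} {c : ℤ → ℝ} (hc : Hyp g c) (X Y : ℝ) (h0 : br c 0 ≤ X) (h1 : X ≤ 0)
    (hB : Br g c X) (hY : |Y - c (-1) / 2| < QQ g c X) (v : ℤ × ℤ) :
    v ∈ localDirs (Gam g c) (X, Y) ↔ v = (0, 1) ∨ v = (0, -1) := by
  obtain ⟨m, n, ε, hε, Hr, Hl, Br', Bl', -⟩ := local_struct hc X h0 h1
  obtain ⟨p, q⟩ := v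
  have hQ := QQ_pos hc X
  constructor
  · rintro ⟨hcop, δ, hδ, H⟩
    simp only [add_smul_vr] at H
    by_cases hp : p = 0
    · subst hp
      have hq : q = 1 ∨ q = -1 := Int.isUnit_iff.mp (isCoprime_zero_left.mp hcop)
      rcases hq with rfl | rfl <;> simp
    · exfalso
      have hcont : Filter.Tendsto (fun t : ℝ => QQ g c (X + t * p) - |Y + t * q - c (-1) / 2|)
          (nhdsWithin 0 (Set.Ioi 0)) (nhds (QQ g c X - |Y - c (-1) / 2|)) := by
        have hh : Continuous (fun t : ℝ => QQ g c (X + t * p) - |Y + t * q - c (-1) / 2|) :=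
          ((QQ_cont g c).comp (by fun_prop)).sub (by fun_prop)
        have h := (hh.tendsto 0).mono_left (nhdsWithin_le_nhds (s := Set.Ioi (0 : ℝ)))
        simpa using h
      have hev := hcont.eventually (lt_mem_nhds (show (0 : ℝ) < _ by linarith))
      have hA : (0 : ℝ) < 1 + |(p : ℝ)| := by positivity
      obtain ⟨t, ⟨ht4, ht0, ht⟩⟩ := (hev.and
        (Ioo_mem_nhdsGT (lt_min hδ (div_pos hε hA)))).exists
      have ht1 : t < δ := lt_of_lt_of_le ht (min_le_left _ _)
      have ht2 : t * (1 + |(p : ℝ)|) < ε :=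
        (lt_div_iff₀ hA).mp (lt_of_lt_of_le ht (min_le_right _ _))
      have hm := ((mem_Gam hc _ _).mp (H t ht0 ht1)).2
      have hb : ¬ Br g c (X + t * p) := by
        rcases lt_or_gt_of_ne hp with hp | hp
        · have hpr : (p : ℝ) < 0 := by exact_mod_cast hp
          rw [abs_of_neg hpr] at ht2
          have e : X + t * p = X - t * (-p : ℝ) := by ring
          rw [e]
          exact Bl' _ (mul_pos ht0 (by linarith)) (by nlinarith)
        · have hpr : (0 : ℝ) < p := by exact_mod_cast hp
          rw [abs_of_pos hpr] at ht2
          exact Br' _ (mul_pos ht0 (by linarith)) (by nlinarith)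
      rcases hm with hm | hm
      · linarith
      · exact hb hm.2
  · intro hv
    have hpq : p = 0 ∧ (q = 1 ∨ q = -1) := by
      rcases hv with hv | hv <;> obtain ⟨rfl, rfl⟩ := Prod.mk.inj hv <;> simp
    obtain ⟨rfl, hq⟩ := hpq
    refine ⟨isCoprime_zero_left.mpr (Int.isUnit_iff.mpr hq),
      QQ g c X - |Y - c (-1) / 2|, by linarith, ?_⟩
    intro t ht0 ht
    rw [add_smul_vr, mem_Gam hc]
    have e : X + t * ((0 : ℤ) : ℝ) = X := by simp
    rw [e]
    refine ⟨⟨h0, h1⟩, Or.inr ⟨?_, hB⟩⟩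
    have e2 : Y + t * q - c (-1) / 2 = (Y - c (-1) / 2) + t * q := by ring
    have e3 : |t * (q : ℝ)| = t := by
      rcases hq with rfl | rfl <;> simp [abs_of_pos ht0]
    rw [e2]
    have := abs_add_le (Y - c (-1) / 2) (t * q)
    linarith

lemma hasSlope_fst (S : Set (ℝ × ℝ)) (P : ℝ × ℝ) (v : ℤ × ℤ) :
    HasSlope S (fun p => p.1) P v v.1 := by
  refine ⟨1, one_pos, ?_⟩
  intro t _ _ _
  simp [vr, mul_comm]

lemma hasSlope_snd (S : Set (ℝ × ℝ)) (P : ℝ × ℝ) (v : ℤ × ℤ) :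
    HasSlope S (fun p => p.2) P v v.2 := by
  refine ⟨1, one_pos, ?_⟩
  intro t _ _ _
  simp [vr, mul_comm]

lemma slope_eq {S : Set (ℝ × ℝ)} {f : ℝ × ℝ → ℝ} {P : ℝ × ℝ} {v : ℤ × ℤ} {s : ℤ}
    (hv : v ∈ localDirs S P) (hs : HasSlope S f P v s) : slope S f P v = s := by
  have hex : ∃ s : ℤ, HasSlope S f P v s := ⟨s, hs⟩
  unfold slope
  rw [dif_pos hex]
  obtain ⟨e1, he1, H1⟩ := hex.choose_spec
  obtain ⟨e2, he2, H2⟩ := hs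
  obtain ⟨-, e3, he3, H3⟩ := hv
  obtain ⟨t, ht0, ht⟩ := exists_between (lt_min he1 (lt_min he2 he3))
  have a1 := lt_of_lt_of_le ht (min_le_left _ _)
  have a2 := lt_of_lt_of_le ht ((min_le_right _ _).trans (min_le_left _ _))
  have a3 := lt_of_lt_of_le ht ((min_le_right _ _).trans (min_le_right _ _))
  have hm := H3 t ht0 a3
  have b1 := H1 t ht0.le a1 hm
  have b2 := H2 t ht0.le a2 hm
  have : ((hex.choose : ℤ) : ℝ) = s := by
    apply mul_right_cancel₀ ht0.ne'
    linarith
  exact_mod_cast this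

lemma ord_eq_sum {S : Set (ℝ × ℝ)} {f : ℝ × ℝ → ℝ} {P : ℝ × ℝ} (sl : ℤ × ℤ → ℤ)
    (hs : ∀ v, HasSlope S f P v (sl v)) (T : Finset (ℤ × ℤ))
    (hT : ∀ v, v ∈ localDirs S P ↔ v ∈ T) : ord S f P = ∑ v ∈ T, sl v := by
  unfold ord
  have hST : localDirs S P = (T : Set (ℤ × ℤ)) := by
    ext v; rw [hT]; simp
  rw [finsum_mem_congr (g := sl) rfl (fun v hv => slope_eq hv (hs v)), hST,
    finsum_mem_coe_finset]

lemma ord_outside {g : ℕ} {c : ℤ → ℝ} (hc : Hyp g c) (f : ℝ × ℝ → ℝ) (P : ℝ × ℝ)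
    (sl : ℤ × ℤ → ℤ) (hs : ∀ v, HasSlope (Gam g c) f P v (sl v)) (hP : P ∉ Gam g c) :
    ord (Gam g c) f P = 0 := by
  rw [ord_eq_sum sl hs ∅]
  · simp
  · intro v
    simp only [Finset.notMem_empty, iff_false]
    exact fun hv => hP (mem_of_localDirs hc P v hv)

lemma ord_edge {g : ℕ} {c : ℤ → ℝ} (hg : 1 ≤ g) (hc : Hyp g c) (X : ℝ) (h0 : br c 0 ≤ X)
    (h1 : X ≤ 0) (σ : ℤ) (hσ : σ = 1 ∨ σ = -1) :
    ord (Gam g c) (fun p => p.1) (X, c (-1) / 2 + σ * QQ g c X) =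
        (if X = br c 0 then 1 else 0) - (if X = 0 then 1 else 0) ∧
    ord (Gam g c) (fun p => p.2) (X, c (-1) / 2 + σ * QQ g c X) =
        (if X = 0 then -σ * (g + 1) else 0) := by
  obtain ⟨m, n, ε, hε, Hr, Hl, Br', Bl', hm0, hmg, hB, hNB⟩ := local_struct hc X h0 h1
  have H := localDirs_edge hc X h0 h1 σ hσ m n ε hε Hr Hl Br' Bl'
  have hlt : br c 0 < 0 := by
    have := br_lt' hc 0 g (by omega) le_rfl
    rwa [br_g hc] at this
  by_cases hx0 : X = br c 0
  · have hb : Br g c X := ⟨0, by omega, hx0⟩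
    have hX0 : X < 0 := by linarith
    have hT : ∀ v, v ∈ localDirs (Gam g c) (X, c (-1) / 2 + σ * QQ g c X) ↔
        v ∈ ({(1, σ * n), (0, -σ)} : Finset (ℤ × ℤ)) := by
      intro v
      rw [H]
      simp [hb, hX0, hx0.le.not_gt]
    rw [ord_eq_sum _ (hasSlope_fst _ _) _ hT, ord_eq_sum _ (hasSlope_snd _ _) _ hT,
      Finset.sum_pair (by simp), Finset.sum_pair (by simp), hB hb, hm0 hx0,
      if_pos hx0, if_neg hX0.ne, if_neg hX0.ne]
    simp
  · have hL : br c 0 < X := lt_of_le_of_ne h0 (Ne.symm hx0)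
    by_cases hx1 : X = 0
    · have hb : Br g c X := ⟨g, le_rfl, by rw [br_g hc]; exact hx1⟩
      have hT : ∀ v, v ∈ localDirs (Gam g c) (X, c (-1) / 2 + σ * QQ g c X) ↔
          v ∈ ({(-1, -(σ * m)), (0, -σ)} : Finset (ℤ × ℤ)) := by
        intro v
        rw [H]
        simp [hb, hL, hx1.ge]
      rw [ord_eq_sum _ (hasSlope_fst _ _) _ hT, ord_eq_sum _ (hasSlope_snd _ _) _ hT,
        Finset.sum_pair (by simp), Finset.sum_pair (by simp), hmg hx1,
        if_neg hx0, if_pos hx1, if_pos hx1]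
      constructor
      · simp
      · ring
    · have hX0 : X < 0 := lt_of_le_of_ne h1 hx1
      rw [if_neg hx0, if_neg hx1, if_neg hx1]
      by_cases hb : Br g c X
      · have hT : ∀ v, v ∈ localDirs (Gam g c) (X, c (-1) / 2 + σ * QQ g c X) ↔
            v ∈ ({(1, σ * n), (-1, -(σ * m)), (0, -σ)} : Finset (ℤ × ℤ)) := by
          intro v
          rw [H]
          simp [hb, hL, hX0]
        rw [ord_eq_sum _ (hasSlope_fst _ _) _ hT, ord_eq_sum _ (hasSlope_snd _ _) _ hT,
          Finset.sum_insert (by simp), Finset.sum_pair (by simp),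
          Finset.sum_insert (by simp), Finset.sum_pair (by simp), hB hb]
        constructor
        · simp
        · push_cast; ring
      · have hT : ∀ v, v ∈ localDirs (Gam g c) (X, c (-1) / 2 + σ * QQ g c X) ↔
            v ∈ ({(1, σ * n), (-1, -(σ * m))} : Finset (ℤ × ℤ)) := by
          intro v
          rw [H]
          simp [hb, hL, hX0]
        rw [ord_eq_sum _ (hasSlope_fst _ _) _ hT, ord_eq_sum _ (hasSlope_snd _ _) _ hT,
          Finset.sum_pair (by simp), Finset.sum_pair (by simp), hNB hb]
        constructor
        · simp
        · push_cast; ring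

lemma ord_mid {g : ℕ} {c : ℤ → ℝ} (hc : Hyp g c) (X Y : ℝ) (h0 : br c 0 ≤ X) (h1 : X ≤ 0)
    (hB : Br g c X) (hY : |Y - c (-1) / 2| < QQ g c X) :
    ord (Gam g c) (fun p => p.1) (X, Y) = 0 ∧ ord (Gam g c) (fun p => p.2) (X, Y) = 0 := by
  have hT : ∀ v, v ∈ localDirs (Gam g c) (X, Y) ↔ v ∈ ({(0, 1), (0, -1)} : Finset (ℤ × ℤ)) := by
    intro v
    rw [localDirs_mid hc X Y h0 h1 hB hY]
    simp
  rw [ord_eq_sum _ (hasSlope_fst _ _) _ hT, ord_eq_sum _ (hasSlope_snd _ _) _ hT,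
    Finset.sum_pair (by simp), Finset.sum_pair (by simp)]
  simp

lemma V_g_eq {g : ℕ} {c : ℤ → ℝ} (hc : Hyp g c) :
    V g c g = (br c 0, c (-1) / 2 + QQ g c (br c 0)) := by
  have h := Ptilde_eq hc (br c 0) 0 (by omega) (fun j hj => by omega) (fun _ => le_rfl)
  unfold QQ
  rw [h]
  simp [V, br]

lemma V_0_eq {g : ℕ} {c : ℤ → ℝ} (hc : Hyp g c) :
    V g c 0 = (0, c (-1) / 2 + QQ g c 0) := by
  have h := Ptilde_eq hc 0 (g + 1) (by omega)
    (fun j hj => by obtain rfl : j = g := by omega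
                    exact (br_g hc).le) (fun h => by omega)
  unfold QQ
  rw [h]
  simp [V, hc.1, hc.2.1]

end TropicalHyperelliptic

open TropicalHyperelliptic

/-- On the bounded part `Γ` of the tropical hyperelliptic curve `Γ̄` of genus
`g`, the coordinate rational functions `x(P) = p` and `y(P) = q` (for
`P = (p,q) ∈ Γ`) have principal divisors
`(x) = V_g + V_g′ − V_0 − V_0′` and `(y) = (g+1)V_0′ − (g+1)V_0`. -/
theorem coordinate_principal_divisors (g : ℕ) (c : ℤ → ℝ) (hg : 1 ≤ g)
    (hc : Hyp g c) :
    IsRationalFn (Gam g c) (fun P => P.1)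
    ∧ IsRationalFn (Gam g c) (fun P => P.2)
    ∧ (∀ P : ℝ × ℝ, ord (Gam g c) (fun p => p.1) P =
        (Finsupp.single (V g c g) (1 : ℤ) + Finsupp.single (conj c (V g c g)) (1 : ℤ)
          - Finsupp.single (V g c 0) (1 : ℤ)
          - Finsupp.single (conj c (V g c 0)) (1 : ℤ)) P)
    ∧ (∀ P : ℝ × ℝ, ord (Gam g c) (fun p => p.2) P =
        (((g : ℤ) + 1) • Finsupp.single (conj c (V g c 0)) (1 : ℤ)
          - ((g : ℤ) + 1) • Finsupp.single (V g c 0) (1 : ℤ)) P) := by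
  have hlt : br c 0 < 0 := by
    have := br_lt' hc 0 g (by omega) le_rfl
    rwa [br_g hc] at this
  refine ⟨⟨continuous_fst.continuousOn, fun P _ v _ => ⟨v.1, hasSlope_fst _ _ _⟩⟩,
    ⟨continuous_snd.continuousOn, fun P _ v _ => ⟨v.2, hasSlope_snd _ _ _⟩⟩, ?_⟩
  rw [← forall_and]
  rintro ⟨X, Y⟩
  have e1 : conj c (V g c g) = (br c 0, c (-1) / 2 - QQ g c (br c 0)) := by
    rw [V_g_eq hc]; unfold TropicalHyperelliptic.conj; ext <;> simp; ring
  have e0 : conj c (V g c 0) = (0, c (-1) / 2 - QQ g c 0) := by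
    rw [V_0_eq hc]; unfold TropicalHyperelliptic.conj; ext <;> simp; ring
  rw [e1, e0, V_g_eq hc, V_0_eq hc]
  classical
  simp only [Finsupp.add_apply, Finsupp.sub_apply, Finsupp.smul_apply, Finsupp.single_apply,
    Prod.mk.injEq, smul_eq_mul]
  by_cases hmem : |Y - c (-1) / 2| = QQ g c X ∧ br c 0 ≤ X ∧ X ≤ 0
  · obtain ⟨hY, h0, h1⟩ := hmem
    have hQ := QQ_pos hc X
    obtain ⟨σ, hσ, rfl⟩ : ∃ σ : ℤ, (σ = 1 ∨ σ = -1) ∧ Y = c (-1) / 2 + σ * QQ g c X := by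
      rcases abs_choice (Y - c (-1) / 2) with h | h
      · exact ⟨1, Or.inl rfl, by push_cast; linarith⟩
      · exact ⟨-1, Or.inr rfl, by push_cast; linarith⟩
    obtain ⟨a, b⟩ := ord_edge hg hc X h0 h1 σ hσ
    rw [a, b]
    have hA : ¬ (QQ g c X = -QQ g c X) := by intro h; linarith
    have hA' : ¬ (-QQ g c X = QQ g c X) := by intro h; linarith
    by_cases hx0 : X = br c 0
    · have hx1 : X ≠ 0 := by rw [hx0]; exact hlt.ne
      rw [← hx0]
      rcases hσ with rfl | rfl <;> simp [hx1, Ne.symm hx1, sub_eq_add_neg, hA, hA']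
    · by_cases hx1 : X = 0
      · subst hx1
        rcases hσ with rfl | rfl <;> simp [hx0, Ne.symm hx0, sub_eq_add_neg, hA, hA']
      · simp [hx0, Ne.symm hx0, hx1, Ne.symm hx1]
  · have hz : ∀ Z W : ℝ, |W - c (-1) / 2| = QQ g c Z → br c 0 ≤ Z → Z ≤ 0 →
        ¬ (Z = X ∧ W = Y) := by
      rintro Z W a b d ⟨rfl, rfl⟩
      exact hmem ⟨a, b, d⟩
    rw [if_neg (hz _ _ (by simp [(QQ_pos hc _).le]) le_rfl hlt.le),
      if_neg (hz _ _ (by simp [(QQ_pos hc _).le]) le_rfl hlt.le),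
      if_neg (hz _ _ (by simp [(QQ_pos hc _).le]) hlt.le le_rfl),
      if_neg (hz _ _ (by simp [(QQ_pos hc _).le]) hlt.le le_rfl)]
    by_cases hG : (X, Y) ∈ Gam g c
    · obtain ⟨⟨h0, h1⟩, h | ⟨h, hB⟩⟩ := (mem_Gam hc X Y).mp hG
      · exact absurd ⟨h, h0, h1⟩ hmem
      · obtain ⟨a, b⟩ := ord_mid hc X Y h0 h1 hB
          (lt_of_le_of_ne h (fun h' => hmem ⟨h', h0, h1⟩))
        rw [a, b]
        simp
    · rw [ord_outside hc _ _ _ (hasSlope_fst _ _) hG, ord_outside hc _ _ _ (hasSlope_snd _ _) hG]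
      simp
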